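/- Let G be a connected finite graph with n vertices, w: D(G) → ℂ a symmetric weight function with weighted matrix W, and set f_G(w,t) = det(I_n − t·W + (D_w − I_n)t^2). Then κ_w(G) = f_G′(w,1) / (2(w(G) − n)), where w(G) = Σ_{uv ∈ E(G)} w(u,v) (assuming w(G) ≠ n). -/

import Mathlib

open Finset SimpleGraph

/-- The weight of an unordered edge coming from a matrix of weights; for a symmetric matrix `M`
this is just the common value `M i j = M j i`. -/
noncomputable def edgeWeight {V : Type*} (M : Matrix V V ℂ) : Sym2 V → ℂ :=
  Sym2.lift ⟨fun i j => (M i j + M j i) / 2, fun i j => by ring⟩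

/-- The weight `w(T) = ∏_{e ∈ E(T)} w(e)` of a spanning tree `T`. -/
noncomputable def treeWeight {V : Type*} (M : Matrix V V ℂ) (T : SimpleGraph V) : ℂ :=
  ∏ᶠ e ∈ T.edgeSet, edgeWeight M e

/-- The weighted complexity `κ_w(G) = Σ_T w(T)`, the sum over all spanning trees of `G`. -/
noncomputable def weightedComplexity {V : Type*} (G : SimpleGraph V) (M : Matrix V V ℂ) : ℂ :=
  ∑ᶠ T ∈ {T : SimpleGraph V | T ≤ G ∧ T.IsTree}, treeWeight M T

/-- The total weight `w(G) = Σ_{uv ∈ E(G)} w(u,v)`. -/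
noncomputable def totalWeight {V : Type*} (G : SimpleGraph V) (M : Matrix V V ℂ) : ℂ :=
  ∑ᶠ e ∈ G.edgeSet, edgeWeight M e

section Aux

variable {V : Type*}

/-- `g` strictly decreases some rank function away from `r`. -/
def Ranked (r : V) (g : V → V) : Prop := ∃ d : V → ℕ, ∀ i, i ≠ r → d (g i) < d i

/-- The graph of the parent function `g`. -/
def parentGraph (r : V) (g : V → V) : SimpleGraph V :=
  SimpleGraph.fromEdgeSet ((fun i => s(i, g i)) '' {i | i ≠ r})

lemma Ranked.ne {r : V} {g : V → V} (h : Ranked r g) {i : V} (hi : i ≠ r) : g i ≠ i := by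
  obtain ⟨d, hd⟩ := h
  intro he
  have := hd i hi
  rw [he] at this
  exact lt_irrefl _ this

lemma Ranked.no_two {r : V} {g : V → V} (h : Ranked r g) {i j : V} (hi : i ≠ r) (hj : j ≠ r)
    (h1 : g i = j) (h2 : g j = i) : False := by
  obtain ⟨d, hd⟩ := h
  have a := hd i hi
  have b := hd j hj
  rw [h1] at a
  rw [h2] at b
  omega

lemma parentGraph_edgeSet {r : V} {g : V → V} (h : Ranked r g) :
    (parentGraph r g).edgeSet = (fun i => s(i, g i)) '' {i | i ≠ r} := by
  unfold parentGraph
  rw [SimpleGraph.edgeSet_fromEdgeSet]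
  ext e
  constructor
  · exact fun h => h.1
  · rintro ⟨i, hi, rfl⟩
    refine ⟨⟨i, hi, rfl⟩, ?_⟩
    simpa using (h.ne hi).symm

lemma Ranked.injOn {r : V} {g : V → V} (h : Ranked r g) :
    Set.InjOn (fun i => s(i, g i)) {i | i ≠ r} := by
  intro i hi j hj hij
  simp only [Sym2.eq_iff] at hij
  rcases hij with h1 | h1
  · exact h1.1
  · exact (h.no_two hi hj h1.2 h1.1.symm).elim

lemma parentGraph_adj {r : V} {g : V → V} (h : Ranked r g) {i : V} (hi : i ≠ r) :
    (parentGraph r g).Adj i (g i) := by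
  rw [← SimpleGraph.mem_edgeSet, parentGraph_edgeSet h]
  exact ⟨i, hi, rfl⟩

lemma parentGraph_connected {r : V} {g : V → V} (h : Ranked r g) :
    (parentGraph r g).Connected := by
  have key : ∀ k i, h.choose i = k → (parentGraph r g).Reachable i r := by
    intro k
    induction k using Nat.strong_induction_on with
    | _ k ih =>
      intro i hk
      by_cases hi : i = r
      · rw [hi]
      · exact (parentGraph_adj h hi).reachable.trans
          (ih _ (hk ▸ h.choose_spec i hi) _ rfl)
  have : Nonempty V := ⟨r⟩
  exact ⟨fun a b => (key _ a rfl).trans (key _ b rfl).symm⟩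

lemma parentGraph_isTree [Finite V] {r : V} {g : V → V} (h : Ranked r g) :
    (parentGraph r g).IsTree := by
  rw [SimpleGraph.isTree_iff_connected_and_card]
  refine ⟨parentGraph_connected h, ?_⟩
  rw [parentGraph_edgeSet h]
  have : Nat.card ((fun i => s(i, g i)) '' {i | i ≠ r}) = Nat.card {i | i ≠ r} :=
    Nat.card_image_of_injOn h.injOn
  rw [this]
  have h2 := Set.ncard_add_ncard_compl ({r} : Set V)
  rw [Set.ncard_singleton] at h2
  have h3 : ({r}ᶜ : Set V) = {i | i ≠ r} := by ext; simp
  rw [h3] at h2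
  rw [← h2, add_comm]
  rfl

lemma parentGraph_inj {r : V} {g h : V → V} (hg : Ranked r g) (hh : Ranked r h)
    (hgr : g r = r) (hhr : h r = r) (he : parentGraph r g = parentGraph r h) : g = h := by
  obtain ⟨d, hd⟩ := id hg
  have key : ∀ k i, d i = k → g i = h i := by
    intro k
    induction k using Nat.strong_induction_on with
    | _ k ih =>
      intro i hk
      by_cases hi : i = r
      · rw [hi, hgr, hhr]
      · have hadj := parentGraph_adj hg hi
        rw [he, ← SimpleGraph.mem_edgeSet, parentGraph_edgeSet hh] at hadj
        obtain ⟨j, hj, hjj⟩ := hadj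
        simp only [Sym2.eq_iff] at hjj
        rcases hjj with ⟨h1, h2⟩ | ⟨h1, h2⟩
        · rw [← h2, h1]
        · have := ih _ (hk ▸ hd i hi) (g i) rfl
          rw [← h1, h2] at this
          exact (hg.no_two hi hj h1.symm this).elim
  exact funext fun i => key _ i rfl

lemma exists_parent [Finite V] {T : SimpleGraph V} (hT : T.IsTree) (r : V) :
    ∃ g : V → V, g r = r ∧ Ranked r g ∧ (∀ i, i ≠ r → T.Adj i (g i)) ∧ parentGraph r g = T := by
  classical
  have hex : ∀ i, i ≠ r → ∃ j, T.Adj i j ∧ T.dist j r < T.dist i r := by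
    intro i hi
    obtain ⟨p, hp⟩ := hT.connected.exists_walk_length_eq_dist i r
    cases p with
    | nil => exact (hi rfl).elim
    | cons hadj q =>
      refine ⟨_, hadj, ?_⟩
      have := SimpleGraph.dist_le q
      rw [SimpleGraph.Walk.length_cons] at hp
      omega
  choose! f hf using hex
  refine ⟨fun i => if i = r then r else f i, by simp, ?_, ?_, ?_⟩
  · exact ⟨fun i => T.dist i r, fun i hi => by simpa [hi] using (hf i hi).2⟩
  · intro i hi
    simpa [hi] using (hf i hi).1
  · have hR : Ranked r (fun i => if i = r then r else f i) :=
      ⟨fun i => T.dist i r, fun i hi => by simpa [hi] using (hf i hi).2⟩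
    have hle : parentGraph r (fun i => if i = r then r else f i) ≤ T := by
      rw [← SimpleGraph.edgeSet_subset_edgeSet, parentGraph_edgeSet hR]
      rintro _ ⟨i, hi, rfl⟩
      have hi' : i ≠ r := hi
      simpa [hi'] using (hf i hi).1
    exact le_antisymm hle
      ((SimpleGraph.isTree_iff_minimal_connected.1 hT).2 (parentGraph_connected hR) hle)

lemma treeWeight_parentGraph [Fintype V] [DecidableEq V] {W : Matrix V V ℂ}
    (hWsym : ∀ i j, W i j = W j i) {r : V} {g : V → V}
    (h : Ranked r g) : treeWeight W (parentGraph r g) = ∏ i, if i = r then 1 else W i (g i) := by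
  unfold treeWeight
  rw [parentGraph_edgeSet h, finprod_mem_image h.injOn]
  have : ∀ i, edgeWeight W s(i, g i) = W i (g i) := by
    intro i
    simp [edgeWeight, hWsym (g i) i]
  simp_rw [this]
  rw [finprod_mem_def, finprod_eq_prod_of_fintype]
  refine Finset.prod_congr rfl fun i _ => ?_
  by_cases hi : i = r <;> simp [Set.mulIndicator, hi]

/-- The matrix of a parent function. -/
def parentMatrix [DecidableEq V] (r : V) (g : V → V) : Matrix V V ℂ :=
  fun i => if i = r then Pi.single r 1 else Pi.single i 1 - Pi.single (g i) 1

lemma det_parentMatrix_of_ranked [Fintype V] [DecidableEq V] {r : V} {g : V → V}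
    (h : Ranked r g) : (parentMatrix r g).det = 1 := by
  obtain ⟨d, hd⟩ := id h
  have hz : ∀ i j, i ≠ j → d i ≤ d j → parentMatrix r g i j = 0 := by
    intro i j hij hle
    unfold parentMatrix
    by_cases hi : i = r
    · subst hi
      simp [hij]
    · have := hd i hi
      have hj : j ≠ g i := by rintro rfl; omega
      simp [hi, hij.symm, hj]
  have hbt : (parentMatrix r g).BlockTriangular (fun i => OrderDual.toDual (d i)) := by
    intro i j hij
    have hij' : d i < d j := hij
    exact hz i j (by rintro rfl; exact lt_irrefl _ hij') hij'.le
  rw [hbt.det]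
  refine Finset.prod_eq_one fun a _ => ?_
  suffices hone : (parentMatrix r g).toSquareBlock (fun i => OrderDual.toDual (d i)) a = 1 by
    rw [hone, Matrix.det_one]
  ext ⟨i, hi⟩ ⟨j, hj⟩
  by_cases hij : i = j
  · subst hij
    by_cases hir : i = r
    · subst hir
      simp [Matrix.toSquareBlock_def, parentMatrix]
    · simp [Matrix.toSquareBlock_def, parentMatrix, hir, (h.ne hir).symm]
  · rw [Matrix.one_apply_ne (by simpa using hij)]
    refine hz i j hij (le_of_eq ?_)
    exact OrderDual.toDual.injective (hi.trans hj.symm)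

lemma det_parentMatrix_of_not_ranked [Fintype V] [DecidableEq V] {r : V} {g : V → V}
    (h : ¬ Ranked r g) : (parentMatrix r g).det = 0 := by
  classical
  rw [← Matrix.exists_mulVec_eq_zero_iff]
  refine ⟨fun i => if ∃ k, g^[k] i = r then 0 else 1, ?_, ?_⟩
  · intro h0
    apply h
    have hall : ∀ i, ∃ k, g^[k] i = r := by
      intro i
      by_contra hc
      have := congrFun h0 i
      simp [if_neg hc] at this
    refine ⟨fun i => Nat.find (hall i), fun i hi => ?_⟩
    have hs := Nat.find_spec (hall i)
    change Nat.find (hall (g i)) < Nat.find (hall i)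
    cases hk : Nat.find (hall i) with
    | zero => rw [hk] at hs; exact (hi hs).elim
    | succ k =>
      rw [hk, Function.iterate_succ_apply] at hs
      have := Nat.find_min' (hall (g i)) hs
      omega
  · ext i
    by_cases hi : i = r
    · subst hi
      have : ∃ k, g^[k] i = i := ⟨0, rfl⟩
      simp [Matrix.mulVec, parentMatrix, this]
    · have : (∃ k, g^[k] i = r) ↔ ∃ k, g^[k] (g i) = r := by
        constructor
        · rintro ⟨k, hk⟩
          cases k with
          | zero => exact (hi hk).elim
          | succ k => exact ⟨k, hk⟩
        · rintro ⟨k, hk⟩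
          exact ⟨k + 1, hk⟩
      have hrow : parentMatrix r g i = Pi.single i 1 - Pi.single (g i) 1 := by
        simp [parentMatrix, hi]
      change parentMatrix r g i ⬝ᵥ _ = 0
      rw [hrow, sub_dotProduct, single_dotProduct, single_dotProduct]
      simp [this]

/-- The weighted Laplacian. -/
def lapW [Fintype V] [DecidableEq V] (W : Matrix V V ℂ) : Matrix V V ℂ :=
  Matrix.diagonal (fun i => ∑ j, W i j) - W

lemma det_expand [Fintype V] [DecidableEq V] (W : Matrix V V ℂ) (r : V) :
    ((lapW W).updateRow r (Pi.single r 1)).det =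
      ∑ g : V → V, (∏ i, if i = r then (if g i = r then 1 else 0) else W i (g i)) *
        (parentMatrix r g).det := by
  have hrow : (lapW W).updateRow r (Pi.single r 1) = fun i => ∑ j,
      (if i = r then (if j = r then 1 else 0) else W i j) •
        (if i = r then Pi.single r 1 else Pi.single i 1 - Pi.single j 1 : V → ℂ) := by
    funext i
    by_cases hi : i = r
    · subst hi
      simp
    · ext k
      simp [Matrix.updateRow_ne hi, hi, lapW, Matrix.diagonal_apply, Pi.single_apply, mul_sub,
        Finset.sum_sub_distrib, eq_comm]
  have := (Matrix.detRowAlternating (n := V) (R := ℂ)).toMultilinearMap.map_sum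
    (fun i j => (if i = r then (if j = r then (1 : ℂ) else 0) else W i j) •
        (if i = r then Pi.single r 1 else Pi.single i 1 - Pi.single j 1 : V → ℂ))
  rw [hrow]
  refine this.trans (Finset.sum_congr rfl fun g _ => ?_)
  rw [MultilinearMap.map_smul_univ]
  rfl

lemma matrix_tree [Fintype V] [DecidableEq V] (G : SimpleGraph V) (W : Matrix V V ℂ)
    (hWsym : ∀ i j, W i j = W j i) (hW0 : ∀ i j, ¬ G.Adj i j → W i j = 0) (r : V) :
    ((lapW W).updateRow r (Pi.single r 1)).det = weightedComplexity G W := by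
  classical
  rw [det_expand]
  have h1 : weightedComplexity G W =
      ∑ᶠ g ∈ {g : V → V | g r = r ∧ (∀ i, i ≠ r → G.Adj i (g i)) ∧ Ranked r g},
        ∏ i, if i = r then 1 else W i (g i) := by
    symm
    refine finsum_mem_eq_of_bijOn (parentGraph r) ⟨?_, ?_, ?_⟩ ?_
    · rintro g ⟨h1, h2, h3⟩
      refine ⟨?_, parentGraph_isTree h3⟩
      rw [← SimpleGraph.edgeSet_subset_edgeSet, parentGraph_edgeSet h3]
      rintro _ ⟨i, hi, rfl⟩
      exact h2 i hi
    · rintro g ⟨h1, h2, h3⟩ h ⟨k1, k2, k3⟩ he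
      exact parentGraph_inj h3 k3 h1 k1 he
    · rintro T ⟨hle, hT⟩
      obtain ⟨g, a, b, c, e⟩ := exists_parent hT r
      exact ⟨g, ⟨a, fun i hi => hle (c i hi), b⟩, e⟩
    · rintro g ⟨h1, h2, h3⟩
      exact (treeWeight_parentGraph hWsym h3).symm
  rw [h1, finsum_mem_def, finsum_eq_sum_of_fintype]
  refine Finset.sum_congr rfl fun g _ => ?_
  rw [Set.indicator_apply]
  split_ifs with hg
  · obtain ⟨h1, h2, h3⟩ := hg
    rw [det_parentMatrix_of_ranked h3, mul_one]
    refine Finset.prod_congr rfl fun i _ => ?_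
    by_cases hi : i = r
    · subst hi; simp [h1]
    · simp [hi]
  · by_cases h3 : Ranked r g
    · by_cases h1 : g r = r
      · have : ∃ i, i ≠ r ∧ ¬ G.Adj i (g i) := by
          by_contra hc
          push Not at hc
          exact hg ⟨h1, hc, h3⟩
        obtain ⟨i, hi, hadj⟩ := this
        rw [Finset.prod_eq_zero (Finset.mem_univ i) (by simp [hi, hW0 _ _ hadj]), zero_mul]
      · rw [Finset.prod_eq_zero (Finset.mem_univ r) (by simp [h1]), zero_mul]
    · rw [det_parentMatrix_of_not_ranked h3, mul_zero]

lemma lapW_row_sum [Fintype V] [DecidableEq V] (W : Matrix V V ℂ) (i : V) :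
    ∑ j, lapW W i j = 0 := by
  simp [lapW, Matrix.diagonal_apply, Finset.sum_sub_distrib]

lemma det_updateRow_eq [Fintype V] [DecidableEq V] (G : SimpleGraph V) (W : Matrix V V ℂ)
    (hWsym : ∀ i j, W i j = W j i) (hW0 : ∀ i j, ¬ G.Adj i j → W i j = 0) (r : V) (c : V → ℂ) :
    ((lapW W).updateRow r c).det = (∑ j, c j) * weightedComplexity G W := by
  have hc : c = (c - (∑ j, c j) • Pi.single r 1) + (∑ j, c j) • Pi.single r 1 := by simp
  have h0 : ((lapW W).updateRow r (c - (∑ j, c j) • Pi.single r 1)).det = 0 := by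
    rw [← Matrix.exists_mulVec_eq_zero_iff]
    refine ⟨fun _ => 1, fun h => one_ne_zero (congrFun h r), ?_⟩
    ext i
    by_cases hi : i = r
    · subst hi
      simp [Matrix.mulVec, dotProduct, Finset.sum_sub_distrib, Pi.single_apply]
    · simp [Matrix.mulVec, dotProduct, Matrix.updateRow_ne hi, lapW_row_sum]
  conv_lhs => rw [hc]
  rw [Matrix.det_updateRow_add, h0, zero_add, Matrix.det_updateRow_smul,
    matrix_tree G W hWsym hW0 r]

lemma hasDerivAt_det [Fintype V] [DecidableEq V] {A : ℂ → Matrix V V ℂ} {A' : Matrix V V ℂ}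
    {t : ℂ} (hA : ∀ i j, HasDerivAt (fun s => A s i j) (A' i j) t) :
    HasDerivAt (fun s => (A s).det) (∑ i, ((A t).updateRow i (A' i)).det) t := by
  let f : ContinuousMultilinearMap ℂ (fun _ : V => V → ℂ) ℂ :=
    { (Matrix.detRowAlternating (n := V) (R := ℂ)).toMultilinearMap with
      cont := by
        change Continuous (fun M : Matrix V V ℂ => M.det)
        fun_prop }
  have hA2 : HasDerivAt (fun s => (fun i j => A s i j : V → V → ℂ)) (fun i j => A' i j) t :=
    hasDerivAt_pi.2 fun i => hasDerivAt_pi.2 fun j => hA i j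
  have := (f.hasFDerivAt (fun i j => A t i j)).comp_hasDerivAt t hA2
  rw [ContinuousMultilinearMap.linearDeriv_apply] at this
  exact this

end Aux

lemma two_mul_totalWeight {n : ℕ} (G : SimpleGraph (Fin n)) (W : Matrix (Fin n) (Fin n) ℂ)
    (hWsym : ∀ i j, W i j = W j i) (hW0 : ∀ i j, ¬ G.Adj i j → W i j = 0) :
    ∑ i, ∑ j, W i j = 2 * totalWeight G W := by
  classical
  have h1 : totalWeight G W = ∑ e ∈ (univ : Finset (Fin n)).sym2 with ¬ e.IsDiag,
      edgeWeight W e := by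
    unfold totalWeight
    refine finsum_mem_eq_sum_of_inter_support_eq _ ?_
    ext e
    induction e using Sym2.ind with
    | _ i j =>
      simp only [Set.mem_inter_iff, SimpleGraph.mem_edgeSet, Function.mem_support, and_congr_left_iff]
      intro hne
      simp only [edgeWeight, Sym2.lift_mk, hWsym j i] at hne
      have hadj : G.Adj i j := by
        by_contra hc
        simp [hW0 _ _ hc] at hne
      simp [hadj, hadj.ne]
  have hed : ∀ i j, edgeWeight W s(i, j) = W i j := by
    intro i j
    simp [edgeWeight, hWsym j i]
  rw [h1, Finset.sum_sym2_filter_not_isDiag]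
  simp_rw [hed]
  have h2 : ∑ p ∈ (univ : Finset (Fin n)).offDiag with p.1 < p.2, W p.1 p.2
      = ∑ i, ∑ j, if i < j then W i j else 0 := by
    rw [← Finset.sum_product', Finset.sum_ite, Finset.sum_const_zero, add_zero]
    refine Finset.sum_congr ?_ fun _ _ => rfl
    ext ⟨i, j⟩
    simp
    exact fun h => h.ne
  rw [h2, two_mul]
  conv_rhs => rhs; rw [Finset.sum_comm]
  rw [← Finset.sum_add_distrib]
  refine Finset.sum_congr rfl fun i _ => ?_
  rw [← Finset.sum_add_distrib]
  refine Finset.sum_congr rfl fun j _ => ?_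
  rcases lt_trichotomy i j with h | h | h
  · simp [h, h.not_gt]
  · subst h
    simp [hW0 i i (G.loopless.irrefl i)]
  · simp [h, h.not_gt, hWsym i j]

theorem stmt4 {n : ℕ} (G : SimpleGraph (Fin n)) [DecidableRel G.Adj]
    (hG : G.Connected) (W : Matrix (Fin n) (Fin n) ℂ)
    (hWsym : ∀ i j, W i j = W j i)
    (hW0 : ∀ i j, ¬ G.Adj i j → W i j = 0)
    (hne : totalWeight G W ≠ (n : ℂ)) :
    weightedComplexity G W =
      deriv (fun t : ℂ => Matrix.det
        ((1 : Matrix (Fin n) (Fin n) ℂ) - t • W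
          + t ^ 2 • (Matrix.diagonal (fun i => ∑ j, W i j) - 1))) 1
        / (2 * (totalWeight G W - n)) := by
  have hd := hasDerivAt_det (t := 1) (A := fun t : ℂ => (1 : Matrix (Fin n) (Fin n) ℂ) - t • W
          + t ^ 2 • (Matrix.diagonal (fun i => ∑ j, W i j) - 1))
          (A' := - W + (2 : ℂ) • (Matrix.diagonal (fun i => ∑ j, W i j) - 1)) (by
    intro i j
    have h1 := ((hasDerivAt_id (1 : ℂ)).mul_const (W i j)).const_sub
      ((1 : Matrix (Fin n) (Fin n) ℂ) i j)
    have h2 := (hasDerivAt_pow 2 (1 : ℂ)).mul_const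
      ((Matrix.diagonal (fun i => ∑ j, W i j) - 1 : Matrix (Fin n) (Fin n) ℂ) i j)
    have h3 := h1.add h2
    have hv : (- W + (2 : ℂ) • (Matrix.diagonal (fun i => ∑ j, W i j) - 1) :
        Matrix (Fin n) (Fin n) ℂ) i j = -(1 * W i j) + ((2 : ℕ) : ℂ) * 1 ^ (2 - 1) *
          (Matrix.diagonal (fun i => ∑ j, W i j) - 1 : Matrix (Fin n) (Fin n) ℂ) i j := by
      simp
    rw [hv]
    exact h3)
  rw [hd.deriv]
  have hL : (1 : Matrix (Fin n) (Fin n) ℂ) - (1 : ℂ) • W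
          + (1 : ℂ) ^ 2 • (Matrix.diagonal (fun i => ∑ j, W i j) - 1) = lapW W := by
    simp only [lapW, one_smul, one_pow]
    abel
  simp only [hL]
  simp_rw [det_updateRow_eq G W hWsym hW0]
  rw [← Finset.sum_mul]
  have hsum : ∑ i, ∑ j, (- W + (2 : ℂ) • (Matrix.diagonal (fun i => ∑ j, W i j) - 1) :
      Matrix (Fin n) (Fin n) ℂ) i j = 2 * (totalWeight G W - n) := by
    have h2 := two_mul_totalWeight G W hWsym hW0
    simp only [Matrix.add_apply, Matrix.neg_apply, Matrix.smul_apply, Matrix.sub_apply,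
      Finset.sum_add_distrib, Finset.sum_neg_distrib, smul_eq_mul, ← Finset.mul_sum,
      Finset.sum_sub_distrib, Matrix.diagonal_apply, Matrix.one_apply, Finset.sum_ite_eq,
      Finset.mem_univ, if_true, h2, Finset.sum_const, Finset.card_univ, Fintype.card_fin,
      nsmul_eq_mul, mul_one]
    ring
  rw [hsum]
  have : 2 * (totalWeight G W - n) ≠ 0 := mul_ne_zero two_ne_zero (sub_ne_zero.2 hne)
  field_simp
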